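/- Define Φ̃(x) = x·ln(ln(x + e)) for x ≥ 0, let C = ln 2 + ln(2e), and for n ∈ ℕ, n ≥ 1, set kₙ = ln(Cn)/n. Then for every n ≥ 1 with ln(Cn) ≥ 1 and every t > 0: ∫₀ᵗ Φ̃( (2ⁿ/n) e^{−2ⁿ(t−s)} / kₙ ) ds ≤ 1 − e^{−2ⁿ t} < 1. -/

import Mathlib

open MeasureTheory

/-- The Young function `Φ̃(x) = x·ln(ln(x+e))` from the diagonal counterexample. -/
noncomputable def PhiTilde (x : ℝ) : ℝ := x * Real.log (Real.log (x + Real.exp 1))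

/-- The constant `C = ln 2 + ln(2e)`. -/
noncomputable def Ccst : ℝ := Real.log 2 + Real.log (2 * Real.exp 1)

/-- The sequence `kₙ = ln(Cn)/n`. -/
noncomputable def kseq (n : ℕ) : ℝ := Real.log (Ccst * n) / n

theorem log_log_add_exp_one_le {n : ℕ} (hn : 1 ≤ n) {x : ℝ} (hx : 0 ≤ x)
    (hxn : x ≤ (2 : ℝ) ^ n) :
    Real.log (Real.log (x + Real.exp 1)) ≤ Real.log (Ccst * n) := by
  have he : (1 : ℝ) < Real.exp 1 := Real.one_lt_exp_iff.2 one_pos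
  have h2 : (1 : ℝ) ≤ (2 : ℝ) ^ n := one_le_pow₀ one_le_two
  have hn' : (1 : ℝ) ≤ n := by exact_mod_cast hn
  have hpos : 0 < Real.log (x + Real.exp 1) := Real.log_pos (by linarith)
  have hlog : 0 ≤ Real.log (2 * Real.exp 1) := Real.log_nonneg (by linarith)
  refine Real.log_le_log hpos ?_
  calc Real.log (x + Real.exp 1) ≤ Real.log ((2 : ℝ) ^ n * (2 * Real.exp 1)) :=
        Real.log_le_log (by linarith) (by nlinarith)
    _ = n * Real.log 2 + Real.log (2 * Real.exp 1) := by
        rw [Real.log_mul (by positivity) (by positivity), Real.log_pow]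
    _ ≤ Ccst * n := by
        unfold Ccst
        nlinarith

theorem phiTilde_le_mul_log {n : ℕ} (hn : 1 ≤ n) {x : ℝ} (hx : 0 ≤ x)
    (hxn : x ≤ (2 : ℝ) ^ n) : PhiTilde x ≤ x * Real.log (Ccst * n) :=
  mul_le_mul_of_nonneg_left (log_log_add_exp_one_le hn hx hxn) hx

theorem lintegral_mul_exp_neg_mul_sub {a t : ℝ} (ha : 0 ≤ a) (ht : 0 ≤ t) :
    ∫⁻ s in Set.Ioo 0 t, ENNReal.ofReal (a * Real.exp (-a * (t - s))) =
      ENNReal.ofReal (1 - Real.exp (-a * t)) := by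
  have hc : Continuous fun s : ℝ => a * Real.exp (-a * (t - s)) := by fun_prop
  have hi : IntegrableOn (fun s : ℝ => a * Real.exp (-a * (t - s))) (Set.Ioo 0 t) :=
    (hc.integrableOn_Icc (a := 0) (b := t)).mono_set Set.Ioo_subset_Icc_self
  rw [← ofReal_integral_eq_lintegral_ofReal hi (Filter.Eventually.of_forall fun s => by positivity),
    ← integral_Ioc_eq_integral_Ioo, ← intervalIntegral.integral_of_le ht,
    intervalIntegral.integral_eq_sub_of_hasDerivAt
      (f := fun s => Real.exp (-a * (t - s))) (fun s _ => ?_) (hc.intervalIntegrable _ _)]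
  · simp
  · refine ((((hasDerivAt_id s).const_sub t).const_mul (-a)).exp).congr_deriv ?_
    simp [mul_comm]

/-- The integral estimate `∫₀ᵗ Φ̃((2ⁿ/n) e^{−2ⁿ(t−s)}/kₙ) ds ≤ 1 − e^{−2ⁿt} < 1` for all
`n` with `kₙ n = ln(Cn) ≥ 1` and all `t > 0`. -/
theorem phiTilde_integral_estimate (n : ℕ) (hn : 1 ≤ n)
    (hln : 1 ≤ Real.log (Ccst * n)) (t : ℝ) (ht : 0 < t) :
    (∫⁻ s in Set.Ioo 0 t,
        ENNReal.ofReal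
          (PhiTilde ((2 : ℝ) ^ n / n * Real.exp (-(2 : ℝ) ^ n * (t - s)) / kseq n))) ≤
      ENNReal.ofReal (1 - Real.exp (-(2 : ℝ) ^ n * t)) ∧
    ENNReal.ofReal (1 - Real.exp (-(2 : ℝ) ^ n * t)) < 1 := by
  have hn' : (0 : ℝ) < n := by exact_mod_cast hn
  refine ⟨?_, ?_⟩
  · rw [← lintegral_mul_exp_neg_mul_sub (by positivity) ht.le]
    refine setLIntegral_mono' measurableSet_Ioo fun s hs => ENNReal.ofReal_le_ofReal ?_
    have hL : 0 < Real.log (Ccst * n) := by linarith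
    have hx : (2 : ℝ) ^ n / n * Real.exp (-(2 : ℝ) ^ n * (t - s)) / kseq n =
        (2 : ℝ) ^ n * Real.exp (-(2 : ℝ) ^ n * (t - s)) / Real.log (Ccst * n) := by
      unfold kseq
      field_simp
    have hexp : Real.exp (-(2 : ℝ) ^ n * (t - s)) ≤ 1 := by
      rw [Real.exp_le_one_iff, neg_mul, neg_nonpos]
      exact mul_nonneg (by positivity) (sub_nonneg.2 hs.2.le)
    rw [hx]
    refine (phiTilde_le_mul_log hn (by positivity) ?_).trans_eq (div_mul_cancel₀ _ hL.ne')
    exact (div_le_self (by positivity) hln).trans (mul_le_of_le_one_right (by positivity) hexp)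
  · rw [ENNReal.ofReal_lt_one]
    linarith [Real.exp_pos (-(2 : ℝ) ^ n * t)]
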